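/- Let Γ be a plumbing tree with framing matrix B, let v_i be a vertex of Γ with weight m, and let Γ∘ be the plumbing tree obtained from Γ by the inverse of the move (C): v_i is replaced by three vertices v', w, v'' forming a chain v' − w − v'', where w has weight 0, v' has weight m_1 and v'' has weight m_2 with m_1 + m_2 = m, and each former neighbor of v_i is joined by an edge to exactly one of v' or v'' (according to an arbitrary partition of the neighbors of v_i); all other vertices, weights, and edges are unchanged. If B∘ denotes the framing matrix of Γ∘, then n_+(B∘) = n_+(B) + 1 and n_-(B∘) = n_-(B) + 1. -/

import Mathlib

/-- A plumbing tree: a finite tree with integer vertex weights (Euler numbers). -/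
structure PlumbingTree (V : Type) [Fintype V] where
  adj : SimpleGraph V
  isTree : adj.IsTree
  weight : V → ℤ

open Classical in
/-- The framing matrix of a plumbing tree, viewed as a real symmetric matrix. -/
noncomputable def framing {V : Type} [Fintype V] (Γ : PlumbingTree V) :
    Matrix V V ℝ :=
  Matrix.of fun i j =>
    if i = j then (Γ.weight i : ℝ) else if Γ.adj.Adj i j then 1 else 0

/-- The number of positive eigenvalues (with multiplicity) of a symmetric real matrix. -/
noncomputable def nPos {V : Type} [Fintype V] [DecidableEq V] (A : Matrix V V ℝ) : ℕ :=
  if h : A.IsHermitian then Nat.card {i // 0 < h.eigenvalues i} else 0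

/-- The number of negative eigenvalues (with multiplicity) of a symmetric real matrix. -/
noncomputable def nNeg {V : Type} [Fintype V] [DecidableEq V] (A : Matrix V V ℝ) : ℕ :=
  if h : A.IsHermitian then Nat.card {i // h.eigenvalues i < 0} else 0

theorem toQuadraticForm'_eq_dotProduct {V R : Type*} [Fintype V] [DecidableEq V] [CommRing R]
    (A : Matrix V V R) (x : V → R) : A.toQuadraticForm' x = x ⬝ᵥ A.mulVec x := by
  rw [Matrix.toQuadraticForm', LinearMap.BilinMap.toQuadraticMap_apply,
    Matrix.toLinearMap₂'_apply']

open Matrix in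
/-- A symmetric real matrix is congruent to the diagonal matrix of its eigenvalues. -/
theorem toQuadraticForm_equivalent_eigenvalues {V : Type} [Fintype V] [DecidableEq V]
    {A : Matrix V V ℝ} (hA : A.IsHermitian) :
    QuadraticMap.Equivalent A.toQuadraticForm'
      (QuadraticMap.weightedSumSquares ℝ hA.eigenvalues) := by
  let U : Matrix V V ℝ := (hA.eigenvectorUnitary : Matrix V V ℝ)
  have h1 : Uᵀ * U = 1 := Unitary.coe_star_mul_self hA.eigenvectorUnitary
  have h2 : U * Uᵀ = 1 := Unitary.coe_mul_star_self hA.eigenvectorUnitary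
  have h3 : Uᵀ * A * U = Matrix.diagonal hA.eigenvalues := by
    have := hA.conjStarAlgAut_star_eigenvectorUnitary
    rwa [Unitary.conjStarAlgAut_star_apply] at this
  refine QuadraticMap.Equivalent.symm ⟨⟨Matrix.toLin'OfInv h1 h2, fun z => ?_⟩⟩
  have hz : (Matrix.toLin'OfInv h1 h2).toFun z = U *ᵥ z := Matrix.toLin'_apply U z
  rw [hz, toQuadraticForm'_eq_dotProduct, Matrix.mulVec_mulVec, Matrix.dotProduct_mulVec,
    ← Matrix.vecMul_transpose, Matrix.vecMul_vecMul, ← Matrix.dotProduct_mulVec, ← mul_assoc, h3]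
  simp only [dotProduct, Matrix.mulVec_diagonal, QuadraticMap.weightedSumSquares_apply, smul_eq_mul]
  exact Finset.sum_congr rfl fun i _ => by ring

theorem nPos_eq_sigPos {V : Type} [Fintype V] [DecidableEq V] {A : Matrix V V ℝ}
    (hA : A.IsHermitian) : nPos A = sigPos A.toQuadraticForm' := by
  rw [QuadraticForm.sigPos_of_equiv_weightedSumSquares (toQuadraticForm_equivalent_eigenvalues hA),
    nPos, dif_pos hA]
  rfl

theorem nNeg_eq_sigNeg {V : Type} [Fintype V] [DecidableEq V] {A : Matrix V V ℝ}
    (hA : A.IsHermitian) : nNeg A = sigNeg A.toQuadraticForm' := by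
  rw [QuadraticForm.sigNeg_of_equiv_weightedSumSquares (toQuadraticForm_equivalent_eigenvalues hA),
    nNeg, dif_pos hA]
  rfl

/-- Splitting off a hyperbolic plane raises both signature counts by one. -/
theorem signature_add_hyperbolic {M M' : Type*} [AddCommGroup M] [Module ℝ M]
    [FiniteDimensional ℝ M] [AddCommGroup M'] [Module ℝ M']
    {Q : QuadraticForm ℝ M} {Q' : QuadraticForm ℝ M'} (e : M' ≃ₗ[ℝ] M × ℝ × ℝ)
    (h : ∀ y, Q' y = Q (e y).1 + (e y).2.1 * (e y).2.2) :
    sigPos Q' = sigPos Q + 1 ∧ sigNeg Q' = sigNeg Q + 1 := by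
  obtain ⟨u, hu⟩ := Q.equivalent_weightedSumSquares
  obtain ⟨d⟩ := hu
  let k : (ℝ × ℝ) ≃ₗ[ℝ] (Fin 2 → ℝ) :=
    { toFun p := ![(p.1 + p.2) / 2, (p.1 - p.2) / 2]
      invFun q := (q 0 + q 1, q 0 - q 1)
      map_add' p q := by ext i; fin_cases i <;> simp <;> ring
      map_smul' r p := by ext i; fin_cases i <;> simp <;> ring
      left_inv p := by ext <;> simp <;> ring
      right_inv q := by ext i; fin_cases i <;> simp }
  have hQ' : QuadraticMap.Equivalent Q'
      (QuadraticMap.weightedSumSquares ℝ (Sum.elim u ![(1 : ℝ), -1])) := by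
    refine ⟨⟨e ≪≫ₗ d.toLinearEquiv.prodCongr k ≪≫ₗ
      (LinearEquiv.sumArrowLequivProdArrow _ _ ℝ ℝ).symm, fun y => ?_⟩⟩
    have hd := d.map_app (e y).1
    rw [h, ← hd]
    simp only [QuadraticMap.weightedSumSquares_apply, Fintype.sum_sum_type]
    simp [k]
    ring
  rw [QuadraticForm.sigPos_of_equiv_weightedSumSquares hQ',
    QuadraticForm.sigNeg_of_equiv_weightedSumSquares hQ',
    QuadraticForm.sigPos_of_equiv_weightedSumSquares ⟨d⟩,
    QuadraticForm.sigNeg_of_equiv_weightedSumSquares ⟨d⟩]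
  constructor
  · have : {i | 0 < Sum.elim u ![(1 : ℝ), -1] i} =
        insert (Sum.inr 0) (Sum.inl '' {i | 0 < u i}) := by
      ext (i | i)
      · simp
      · fin_cases i <;> simp
    rw [this, Set.ncard_insert_of_notMem (by simp), Set.ncard_image_of_injective _ Sum.inl_injective]
  · have : {i | Sum.elim u ![(1 : ℝ), -1] i < 0} =
        insert (Sum.inr 1) (Sum.inl '' {i | u i < 0}) := by
      ext (i | i)
      · simp
      · fin_cases i <;> simp
    rw [this, Set.ncard_insert_of_notMem (by simp), Set.ncard_image_of_injective _ Sum.inl_injective]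

theorem framing_isHermitian {V : Type} [Fintype V] (Γ : PlumbingTree V) :
    (framing Γ).IsHermitian := by
  ext i j
  have := Γ.adj.adj_comm i j
  simp only [framing, Matrix.conjTranspose_apply, Matrix.of_apply, star_trivial]
  grind

/-- Deleting an edge of a forest admits a sign function separating its endpoints that is constant
along all other edges. -/
theorem SimpleGraph.IsAcyclic.exists_sign {W : Type*} {G : SimpleGraph W} (hG : G.IsAcyclic)
    {a b : W} (hab : G.Adj a b) :
    ∃ ε : W → ℝ, (∀ x, ε x * ε x = 1) ∧ ε a = 1 ∧ ε b = -1 ∧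
      ∀ x y, G.Adj x y → s(x, y) ≠ s(a, b) → ε x = ε y := by
  classical
  refine ⟨fun x => if (G.deleteEdges {s(a, b)}).Reachable a x then 1 else -1, fun x => ?_, ?_, ?_,
    fun x y hxy hne => ?_⟩
  · dsimp only
    split_ifs <;> norm_num
  · simp
  · exact if_neg (SimpleGraph.isBridge_iff.mp
      (SimpleGraph.isAcyclic_iff_forall_adj_isBridge.mp hG hab))
  · have hr : (G.deleteEdges {s(a, b)}).Reachable x y :=
      SimpleGraph.Adj.reachable
        (by simpa [SimpleGraph.deleteEdges_adj] using ⟨hxy, by simpa using hne⟩)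
    have : (G.deleteEdges {s(a, b)}).Reachable a x ↔ (G.deleteEdges {s(a, b)}).Reachable a y :=
      ⟨fun h => h.trans hr, fun h => h.trans hr.symm⟩
    simp only [this]

/-- A sum over a type that extends the image of `f` by two further points. -/
theorem sum_eq_add_add_sum_image {V W : Type*} [Fintype V] [Fintype W] {f : V → W} {w w'' : W}
    (hf : Function.Injective f) (hww'' : w ≠ w'') (hw : ∀ v, f v ≠ w) (hw'' : ∀ v, f v ≠ w'')
    (hsurj : ∀ x : W, x = w ∨ x = w'' ∨ ∃ v, f v = x) {N : Type*} [AddCommMonoid N] (g : W → N) :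
    ∑ x, g x = g w + (g w'' + ∑ v, g (f v)) := by
  let φ : Option (Option V) → W := fun o => o.elim w fun p => p.elim w'' f
  have hφ : Function.Bijective φ := by
    constructor
    · rintro (_ | _ | a) (_ | _ | b) hab <;> simp_all [φ] <;> grind
    · intro x
      rcases hsurj x with rfl | rfl | ⟨v, rfl⟩
      · exact ⟨none, rfl⟩
      · exact ⟨some none, rfl⟩
      · exact ⟨some (some v), rfl⟩
  rw [← hφ.sum_comp g, Fintype.sum_option, Fintype.sum_option]
  rfl

/-- **Inverse Neumann move (C) and the signature.**
If `Γ'` is obtained from the plumbing tree `Γ` by the inverse of the move (C):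
the vertex `vi` of weight `m` is replaced by a chain `v' − w − v''` (here
`v' = f vi`, `w` has weight `0`, `v'` has weight `m₁`, `v''` has weight `m₂`
with `m₁ + m₂ = m`), and each former neighbor of `vi` is joined to exactly one
of `v'`, `v''` according to an arbitrary partition (given by the predicate `P`)
of the neighbors of `vi`; everything else unchanged. Then
`n₊(B∘) = n₊(B) + 1` and `n₋(B∘) = n₋(B) + 1` for the framing matrices. -/
theorem neumann_move_C_inverse_signature
    {V W : Type} [Fintype V] [DecidableEq V] [Fintype W] [DecidableEq W]
    (Γ : PlumbingTree V) (Γ' : PlumbingTree W)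
    (vi : V) (m₁ m₂ : ℤ) (hm : m₁ + m₂ = Γ.weight vi)
    (f : V → W) (w w'' : W) (P : V → Prop)
    (hf : Function.Injective f)
    (hww'' : w ≠ w'')
    (hw : ∀ v, f v ≠ w) (hw'' : ∀ v, f v ≠ w'')
    (hsurj : ∀ x : W, x = w ∨ x = w'' ∨ ∃ v, f v = x)
    (hwt1 : Γ'.weight (f vi) = m₁)
    (hwt2 : Γ'.weight w'' = m₂)
    (hwt0 : Γ'.weight w = 0)
    (hwtother : ∀ v, v ≠ vi → Γ'.weight (f v) = Γ.weight v)
    (hadjw : ∀ x, Γ'.adj.Adj w x ↔ (x = f vi ∨ x = w''))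
    (hadjw'' : ∀ v, Γ'.adj.Adj w'' (f v) ↔ (v ≠ vi ∧ Γ.adj.Adj v vi ∧ ¬ P v))
    (hadjvi : ∀ v, v ≠ vi → (Γ'.adj.Adj (f v) (f vi) ↔ (Γ.adj.Adj v vi ∧ P v)))
    (hadjf : ∀ a b, a ≠ vi → b ≠ vi → (Γ'.adj.Adj (f a) (f b) ↔ Γ.adj.Adj a b)) :
    nPos (framing Γ') = nPos (framing Γ) + 1 ∧
    nNeg (framing Γ') = nNeg (framing Γ) + 1 := by
  obtain ⟨ε, hεsq, hε1, hε2, hε⟩ :=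
    Γ'.isTree.isAcyclic.exists_sign ((hadjw w'').2 (Or.inr rfl))
  have hsum {N : Type} [AddCommMonoid N] (g : W → N) :=
    sum_eq_add_add_sum_image hf hww'' hw hw'' hsurj g
  have hεvi : ε (f vi) = 1 := by
    rw [← hε1]
    exact (hε _ _ ((hadjw _).2 (Or.inl rfl)) (by simp [hw'' vi, hww''])).symm
  classical
  let n : V → ℝ := fun v => if Γ'.adj.Adj w'' (f v) then 1 else 0
  have hnε (v : V) : n v * ε (f v) = -n v := by
    by_cases h : Γ'.adj.Adj w'' (f v)
    · simp [n, h, ← hε _ _ h (by simp [hw v, hw'' v, hww''.symm]), hε2]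
    · simp [n, h]
  have hB1 : framing Γ' w w = 0 := by simp [framing, hwt0]
  have hB2 : framing Γ' w w'' = 1 := by simp [framing, hww'', hadjw]
  have hB3 : framing Γ' w'' w'' = m₂ := by simp [framing, hwt2]
  have hB4 (v : V) : framing Γ' w (f v) = if v = vi then 1 else 0 := by
    simp [framing, (hw v).symm, hadjw, hw'' v, hf.eq_iff]
  have hB5 (v : V) : framing Γ' w'' (f v) = n v := by
    simp [framing, (hw'' v).symm, n]
  have hsymm (x y : W) : framing Γ' x y = framing Γ' y x :=
    (framing_isHermitian Γ').apply y x
  have hB6 (a b : V) : framing Γ' (f a) (f b) = ε (f a) * ε (f b) *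
      (framing Γ a b - (if a = vi then n b else 0) - (if b = vi then n a else 0) -
        if a = vi then if b = vi then (m₂ : ℝ) else 0 else 0) := by
    have hedge : Γ'.adj.Adj (f a) (f b) → ε (f a) = ε (f b) := fun h =>
      hε _ _ h (by simp [hw a, hw b])
    have ha := hεsq (f a)
    have hadj := Γ'.adj.adj_comm (f a) (f b)
    have hadj' := Γ.adj.adj_comm a b
    have hm' : (m₁ : ℝ) + m₂ = Γ.weight vi := by exact_mod_cast hm
    simp only [framing, Matrix.of_apply, hf.eq_iff, n]
    by_cases hav : a = vi <;> by_cases hbv : b = vi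
    · subst hav hbv
      simp [hwt1, hεvi, hadjw'']
      linarith
    · subst hav
      have := hadjvi b hbv
      have := hadjw'' b
      simp only [hεvi] at *
      grind
    · subst hbv
      have := hadjvi a hav
      have := hadjw'' a
      simp only [hεvi] at *
      grind
    · have := hadjf a b hav hbv
      have := hwtother a hav
      grind
  let p (x : W) : (W → ℝ) →ₗ[ℝ] ℝ := LinearMap.proj x
  let s : (W → ℝ) →ₗ[ℝ] ℝ := (2 * m₂ : ℝ) • p (f vi) - (m₂ : ℝ) • (p w'' + p (f vi)) +
    (2 : ℝ) • ∑ v, (n v * ε (f v)) • p (f v) - (2 : ℝ) • p w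
  let L : (W → ℝ) →ₗ[ℝ] (V → ℝ) × ℝ × ℝ :=
    (LinearMap.pi fun v => ε (f v) • p (f v)).prod ((-(p w'' + p (f vi))).prod s)
  have hL1 (y : W → ℝ) : (L y).1 = fun v => ε (f v) * y (f v) := rfl
  have hL2 (y : W → ℝ) : (L y).2.1 = -(y w'' + y (f vi)) := rfl
  have hL3 (y : W → ℝ) : (L y).2.2 = 2 * m₂ * y (f vi) - m₂ * (y w'' + y (f vi)) +
      2 * ∑ v, n v * ε (f v) * y (f v) - 2 * y w := by
    simp [L, s, p, mul_add]
  have hinj : Function.Injective L := by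
    rw [injective_iff_map_eq_zero]
    intro y hy
    have hy1 (v : V) : y (f v) = 0 := by
      have h := congrFun ((hL1 y).symm.trans (congrArg Prod.fst hy)) v
      have := hεsq (f v)
      simp only [Prod.fst_zero, Pi.zero_apply] at h
      grind
    have hy2 : y w'' = 0 := by
      have h := hL2 y
      simp only [hy, hy1, Prod.snd_zero, Prod.fst_zero] at h
      linarith
    have hy3 : y w = 0 := by
      have h := hL3 y
      simp only [hy, hy1, hy2, Prod.snd_zero, mul_zero, Finset.sum_const_zero] at h
      linarith
    ext x
    rcases hsurj x with rfl | rfl | ⟨v, rfl⟩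
    · exact hy3
    · exact hy2
    · exact hy1 v
  have hcard : Fintype.card W = Fintype.card V + 2 := by
    have := hsum fun _ => 1
    simp only [Finset.sum_const, Finset.card_univ, smul_eq_mul, mul_one] at this
    omega
  have hrank : Module.finrank ℝ (W → ℝ) = Module.finrank ℝ ((V → ℝ) × ℝ × ℝ) := by
    simp [hcard]
  rw [nPos_eq_sigPos (framing_isHermitian Γ'), nPos_eq_sigPos (framing_isHermitian Γ),
    nNeg_eq_sigNeg (framing_isHermitian Γ'), nNeg_eq_sigNeg (framing_isHermitian Γ)]
  refine signature_add_hyperbolic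
    (LinearMap.linearEquivOfInjective L hinj hrank) fun y => ?_
  rw [LinearMap.linearEquivOfInjective_apply, toQuadraticForm'_eq_dotProduct,
    toQuadraticForm'_eq_dotProduct, hL1, hL2, hL3]
  have hker : ∑ a, y (f a) * ∑ b, framing Γ' (f a) (f b) * y (f b) =
      ∑ a, ε (f a) * y (f a) * ∑ b, framing Γ a b * (ε (f b) * y (f b)) -
        2 * y (f vi) * ∑ b, n b * ε (f b) * y (f b) - m₂ * y (f vi) ^ 2 := by
    have hterm (a b : V) : y (f a) * (framing Γ' (f a) (f b) * y (f b)) =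
        ε (f a) * y (f a) * (framing Γ a b * (ε (f b) * y (f b))) -
        (if a = vi then y (f vi) * (n b * ε (f b) * y (f b)) else 0) -
        (if b = vi then y (f vi) * (n a * ε (f a) * y (f a)) else 0) -
        (if a = vi then if b = vi then m₂ * y (f vi) ^ 2 else 0 else 0) := by
      rw [hB6]
      by_cases ha : a = vi <;> by_cases hb : b = vi <;>
        simp only [ha, hb, if_true, if_false, hεvi] <;> ring
    simp_rw [Finset.mul_sum, hterm, Finset.sum_sub_distrib]
    simp only [Finset.sum_ite_irrel, Finset.sum_ite_eq', Finset.mem_univ, if_true,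
      Finset.sum_const_zero, ← Finset.mul_sum]
    ring
  have hn : ∑ v, n v * y (f v) = -∑ v, n v * ε (f v) * y (f v) := by
    simp [hnε]
  have hn' : ∑ v, y (f v) * (n v * y w'') = y w'' * ∑ v, n v * y (f v) := by
    rw [Finset.mul_sum]
    exact Finset.sum_congr rfl fun v _ => by ring
  simp only [dotProduct, Matrix.mulVec, hsum, hsymm (f _) w, hsymm (f _) w'', hsymm w'' w, hB1, hB2,
    hB3, hB4, hB5, mul_add, Finset.sum_add_distrib, hker, hn', hn]
  simp only [zero_mul, one_mul, ite_mul, Finset.sum_ite_eq', Finset.mem_univ, if_true, mul_ite,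
    mul_zero]
  ring
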